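/- arXiv:1803.03572 — 2 statements merged into one kernel-verified Lean document; each statement's English description precedes it below -/
import Mathlib

section
/- Let S be a finite-dimensional semisimple algebra over ℂ, let I_S be the set of isomorphism classes of simple left S-modules, and choose a representative V_i for each i ∈ I_S. For a permutation σ of I_S, set X_σ = ⊕_{i ∈ I_S} V_{σ(i)} ⊗_ℂ V_i^*, an S-bimodule where S acts on the left through the factors V_{σ(i)} and on the right through the dual spaces V_i^* = Hom_ℂ(V_i, ℂ). Then for any two permutations σ, σ' of I_S there is an isomorphism of S-bimodules X_σ ⊗_S X_{σ'} ≅ X_{σ∘σ'}. -/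
set_option maxSynthPendingDepth 3

open TensorProduct
open scoped DirectSum

/-- `X_σ = ⊕_{i} V_{σ(i)} ⊗_ℂ V_i^*`. -/
abbrev Xmod (ι : Type) (V : ι → Type) [∀ i, AddCommGroup (V i)]
    [∀ i, Module ℂ (V i)] (σ : Equiv.Perm ι) : Type :=
  ⨁ i : ι, (V (σ i) ⊗[ℂ] Module.Dual ℂ (V i))

/-- The left action of `s ∈ S` on `X_σ`, acting through the factors `V_{σ(i)}`. -/
noncomputable def lAct (S : Type) [Ring S] [Algebra ℂ S]
    (ι : Type) [DecidableEq ι] (V : ι → Type) [∀ i, AddCommGroup (V i)]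
    [∀ i, Module ℂ (V i)] [∀ i, Module S (V i)] [∀ i, SMulCommClass S ℂ (V i)]
    (σ : Equiv.Perm ι) (s : S) : Xmod ι V σ →ₗ[ℂ] Xmod ι V σ :=
  DirectSum.toModule ℂ ι (Xmod ι V σ) fun i =>
    (DirectSum.lof ℂ ι (fun j => V (σ j) ⊗[ℂ] Module.Dual ℂ (V j)) i).comp
      (LinearMap.rTensor (Module.Dual ℂ (V i))
        (DistribMulAction.toLinearMap ℂ (V (σ i)) s))

/-- The right action of `s ∈ S` on `X_σ`, acting through the dual spaces `V_i^*`
by `(f·s)(v) = f(s·v)`. -/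
noncomputable def rAct (S : Type) [Ring S] [Algebra ℂ S]
    (ι : Type) [DecidableEq ι] (V : ι → Type) [∀ i, AddCommGroup (V i)]
    [∀ i, Module ℂ (V i)] [∀ i, Module S (V i)] [∀ i, SMulCommClass S ℂ (V i)]
    (σ : Equiv.Perm ι) (s : S) : Xmod ι V σ →ₗ[ℂ] Xmod ι V σ :=
  DirectSum.toModule ℂ ι (Xmod ι V σ) fun i =>
    (DirectSum.lof ℂ ι (fun j => V (σ j) ⊗[ℂ] Module.Dual ℂ (V j)) i).comp
      (LinearMap.lTensor (V (σ i))
        ((DistribMulAction.toLinearMap ℂ (V i) s).dualMap))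

/-- The balancing relations defining the tensor product over `S`,
`X_σ ⊗_S X_{σ'}`, as a quotient of `X_σ ⊗[ℂ] X_{σ'}`:
the span of the elements `(x·s) ⊗ y - x ⊗ (s·y)`. -/
noncomputable def balRel (S : Type) [Ring S] [Algebra ℂ S]
    (ι : Type) [DecidableEq ι] (V : ι → Type) [∀ i, AddCommGroup (V i)]
    [∀ i, Module ℂ (V i)] [∀ i, Module S (V i)] [∀ i, SMulCommClass S ℂ (V i)]
    (σ σ' : Equiv.Perm ι) :
    Submodule ℂ (Xmod ι V σ ⊗[ℂ] Xmod ι V σ') :=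
  Submodule.span ℂ
    {z | ∃ (s : S) (a : Xmod ι V σ) (b : Xmod ι V σ'),
      z = (rAct S ι V σ s a) ⊗ₜ[ℂ] b - a ⊗ₜ[ℂ] (lAct S ι V σ' s b)}

theorem Xaux_density
    (S : Type) [Ring S] [Algebra ℂ S] [FiniteDimensional ℂ S] [IsSemisimpleRing S]
    (ι : Type) [Fintype ι] [DecidableEq ι]
    (V : ι → Type) [∀ i, AddCommGroup (V i)] [∀ i, Module ℂ (V i)]
    [∀ i, Module S (V i)] [∀ i, SMulCommClass S ℂ (V i)]
    [∀ i, IsScalarTower ℂ S (V i)]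
    (hsimple : ∀ i, IsSimpleModule S (V i))
    (hinj : ∀ i j, Nonempty (V i ≃ₗ[S] V j) → i = j)
    (i : ι) (T : V i →ₗ[ℂ] V i) :
    ∃ s : S, (∀ x : V i, s • x = T x) ∧ ∀ j, j ≠ i → ∀ x : V j, s • x = 0 := by
  have hfin : ∀ j, Module.Finite ℂ (V j) := fun j => Module.Finite.trans S (V j)
  -- endomorphisms of the product act diagonally by scalars
  have key : ∀ (φ : Module.End S (∀ j, V j)) (m : ∀ j, V j),
      ∃ c : ℂ, ∀ x : (∀ j, V j), φ x i = c • x i := by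
    intro φ _
    have hs := (IsSimpleModule.algebraMap_end_bijective_of_isAlgClosed (A := S) (V := V i) ℂ).2
      ((LinearMap.proj i).comp (φ.comp (LinearMap.single S V i)))
    obtain ⟨c, hc⟩ := hs
    refine ⟨c, fun x => ?_⟩
    have hx : x = ∑ j, Pi.single j (x j) := (Finset.univ_sum_single x).symm
    have h1 : φ x i = ∑ j, φ (Pi.single j (x j)) i := by
      conv_lhs => rw [hx]
      rw [map_sum, Finset.sum_apply]
    rw [h1, Finset.sum_eq_single i]
    · have := LinearMap.congr_fun hc (x i)
      simpa using this.symm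
    · intro j _ hj
      rcases LinearMap.bijective_or_eq_zero
        ((LinearMap.proj i).comp (φ.comp (LinearMap.single S V j)) : V j →ₗ[S] V i) with h | h
      · exact absurd (hinj j i ⟨LinearEquiv.ofBijective _ h⟩) hj
      · have := LinearMap.congr_fun h (x j)
        simpa using this
    · simp
  have key2 : ∀ (φ : Module.End S (∀ j, V j)) (y : V i) (j : ι), j ≠ i →
      φ (Pi.single i y) j = 0 := by
    intro φ y j hj
    rcases LinearMap.bijective_or_eq_zero
        ((LinearMap.proj j).comp (φ.comp (LinearMap.single S V i)) : V i →ₗ[S] V j) with h | h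
    · exact absurd (hinj i j ⟨LinearEquiv.ofBijective _ h⟩).symm hj
    · have := LinearMap.congr_fun h y
      simpa using this
  let f : Module.End (Module.End S (∀ j, V j)) (∀ j, V j) :=
    { toFun := fun x => Pi.single i (T (x i))
      map_add' := fun x y => by simp [Pi.single_add]
      map_smul' := fun φ x => by
        obtain ⟨c, hc⟩ := key φ x
        ext j
        by_cases hj : j = i
        · subst hj
          simp [Module.End.smul_def, hc]
        · simp [Module.End.smul_def, key2 φ _ j hj, Pi.single_eq_of_ne hj] }
  obtain ⟨B, hB⟩ := Module.Finite.fg_top (R := ℂ) (M := ∀ j, V j)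
  obtain ⟨r, hr⟩ := jacobson_density f B
  have hall : ∀ m : (∀ j, V j), r • m = Pi.single i (T (m i)) := by
    intro m
    have hm : m ∈ Submodule.span ℂ (B : Set (∀ j, V j)) := by rw [hB]; trivial
    induction hm using Submodule.span_induction with
    | mem m hm => exact (hr m hm).symm
    | zero => simp
    | add x y _ _ h1 h2 => simp [smul_add, h1, h2, Pi.single_add]
    | smul c x _ h => rw [smul_comm, h]; simp [Pi.single_smul]
  refine ⟨r, fun x => ?_, fun j hj x => ?_⟩
  · simpa using congrFun (hall (Pi.single i x)) i
  · have := congrFun (hall (Pi.single j x)) j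
    simpa [Pi.single_eq_of_ne hj, Pi.single_eq_of_ne (Ne.symm hj)] using this

/-- Contraction `(A ⊗ W^*) × (W ⊗ D) → A ⊗ D`. -/
noncomputable def Xcontr (A W D : Type) [AddCommGroup A] [Module ℂ A] [AddCommGroup W]
    [Module ℂ W] [AddCommGroup D] [Module ℂ D] :
    (A ⊗[ℂ] Module.Dual ℂ W) →ₗ[ℂ] (W ⊗[ℂ] D) →ₗ[ℂ] (A ⊗[ℂ] D) :=
  TensorProduct.lift (LinearMap.mk₂ ℂ
    (fun a f => (TensorProduct.mk ℂ A D a).comp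
      ((TensorProduct.lid ℂ D).toLinearMap.comp (LinearMap.rTensor D f)))
    (fun a a' f => by ext; simp [TensorProduct.add_tmul])
    (fun c a f => by ext; simp [TensorProduct.smul_tmul'])
    (fun a f f' => by ext; simp [TensorProduct.tmul_add, add_smul])
    (fun c a f => by ext; simp [mul_smul]))

theorem Xcontr_tmul (A W D : Type) [AddCommGroup A] [Module ℂ A] [AddCommGroup W]
    [Module ℂ W] [AddCommGroup D] [Module ℂ D] (a : A) (f : Module.Dual ℂ W) (w : W) (d : D) :
    Xcontr A W D (a ⊗ₜ f) (w ⊗ₜ d) = f w • (a ⊗ₜ[ℂ] d) := by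
  simp [Xcontr]

section Xaux
variable (S : Type) [Ring S] [Algebra ℂ S]
    (ι : Type) [DecidableEq ι]
    (V : ι → Type) [∀ i, AddCommGroup (V i)] [∀ i, Module ℂ (V i)]
    [∀ i, Module S (V i)] [∀ i, SMulCommClass S ℂ (V i)]
    (σ σ' : Equiv.Perm ι)

/-- Pure elements of `X_σ`. -/
noncomputable def Xp (i : ι) (v : V (σ i)) (f : Module.Dual ℂ (V i)) : Xmod ι V σ :=
  DirectSum.lof ℂ ι (fun j => V (σ j) ⊗[ℂ] Module.Dual ℂ (V j)) i (v ⊗ₜ[ℂ] f)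

variable {ι V} in
theorem Xp_ext {N : Type} [AddCommGroup N] [Module ℂ N] {σ : Equiv.Perm ι}
    {F G : Xmod ι V σ →ₗ[ℂ] N} (h : ∀ i v f, F (Xp ι V σ i v f) = G (Xp ι V σ i v f)) : F = G := by
  refine DirectSum.linearMap_ext ℂ fun i => ?_
  refine TensorProduct.ext' fun v f => ?_
  exact h i v f

theorem lAct_Xp (s : S) (i : ι) (v : V (σ i)) (f : Module.Dual ℂ (V i)) :
    lAct S ι V σ s (Xp ι V σ i v f) = Xp ι V σ i (s • v) f := by
  simp [lAct, Xp, DirectSum.toModule_lof]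
  rfl

theorem rAct_Xp (s : S) (i : ι) (v : V (σ i)) (f : Module.Dual ℂ (V i)) :
    rAct S ι V σ s (Xp ι V σ i v f) =
      Xp ι V σ i v (f.comp (DistribSMul.toLinearMap ℂ (V i) s)) := by
  simp [rAct, Xp, DirectSum.toModule_lof]
  rfl

/-- The identity `V (σ (σ' j)) = V ((σ * σ') j)`. -/
noncomputable def Xc (j : ι) : V (σ (σ' j)) ≃ₗ[ℂ] V ((σ * σ') j) := LinearEquiv.refl ℂ (V (σ (σ' j)))

theorem Xc_smul (j : ι) (s : S) (v : V (σ (σ' j))) :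
    Xc ι V σ σ' j (s • v) = s • Xc ι V σ σ' j v := rfl

/-- The bilinear map underlying the isomorphism. -/
noncomputable def Xphi : Xmod ι V σ →ₗ[ℂ] Xmod ι V σ' →ₗ[ℂ] Xmod ι V (σ * σ') :=
  LinearMap.flip (DirectSum.toModule ℂ ι (Xmod ι V σ →ₗ[ℂ] Xmod ι V (σ * σ')) fun j =>
    LinearMap.flip (((Xcontr (V (σ (σ' j))) (V (σ' j)) (Module.Dual ℂ (V j))).compr₂
      ((DirectSum.lof ℂ ι (fun j => V ((σ * σ') j) ⊗[ℂ] Module.Dual ℂ (V j)) j).comp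
        (LinearMap.rTensor (Module.Dual ℂ (V j)) (Xc ι V σ σ' j).toLinearMap))).comp
      (DirectSum.component ℂ ι (fun j => V (σ j) ⊗[ℂ] Module.Dual ℂ (V j)) (σ' j))))

theorem Xphi_same (j : ι) (v : V (σ (σ' j))) (f : Module.Dual ℂ (V (σ' j)))
    (w : V (σ' j)) (g : Module.Dual ℂ (V j)) :
    Xphi ι V σ σ' (Xp ι V σ (σ' j) v f) (Xp ι V σ' j w g) = f w • Xp ι V (σ * σ') j (Xc ι V σ σ' j v) g := by
  simp only [Xphi, Xp, LinearMap.flip_apply, DirectSum.toModule_lof, LinearMap.comp_apply,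
    LinearMap.compr₂_apply, DirectSum.component.lof_self]
  rw [Xcontr_tmul, map_smul, LinearMap.rTensor_tmul, map_smul]
  rfl

theorem Xphi_ne (i j : ι) (h : i ≠ σ' j) (v : V (σ i)) (f : Module.Dual ℂ (V i))
    (w : V (σ' j)) (g : Module.Dual ℂ (V j)) :
    Xphi ι V σ σ' (Xp ι V σ i v f) (Xp ι V σ' j w g) = 0 := by
  simp only [Xphi, Xp, LinearMap.flip_apply, DirectSum.toModule_lof, LinearMap.comp_apply,
    LinearMap.compr₂_apply]
  rw [DirectSum.component.of, dif_neg h]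
  simp only [map_zero, LinearMap.zero_apply]

variable {ι V} in
theorem Xphi_ext {N : Type} [AddCommGroup N] [Module ℂ N] {σ σ' : Equiv.Perm ι}
    {F G : Xmod ι V σ →ₗ[ℂ] Xmod ι V σ' →ₗ[ℂ] N}
    (h1 : ∀ i j v f w g, i ≠ σ' j →
      F (Xp ι V σ i v f) (Xp ι V σ' j w g) = G (Xp ι V σ i v f) (Xp ι V σ' j w g))
    (h2 : ∀ j v f w g,
      F (Xp ι V σ (σ' j) v f) (Xp ι V σ' j w g) = G (Xp ι V σ (σ' j) v f) (Xp ι V σ' j w g)) :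
    F = G := by
  refine Xp_ext fun i v f => Xp_ext fun j w g => ?_
  by_cases h : i = σ' j
  · subst h; exact h2 ..
  · exact h1 _ _ _ _ _ _ h

theorem Xphi_bal (s : S) (a : Xmod ι V σ) (b : Xmod ι V σ') :
    Xphi ι V σ σ' (rAct S ι V σ s a) b = Xphi ι V σ σ' a (lAct S ι V σ' s b) := by
  have : (Xphi ι V σ σ').comp (rAct S ι V σ s) =
      (Xphi ι V σ σ').compl₂ (lAct S ι V σ' s) := by
    refine Xphi_ext (fun i j v f w g h => ?_) (fun j v f w g => ?_)
    · simp only [LinearMap.comp_apply, LinearMap.compl₂_apply, lAct_Xp, rAct_Xp, Xphi_ne _ _ _ _ _ _ h]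
    · simp only [LinearMap.comp_apply, LinearMap.compl₂_apply, lAct_Xp, rAct_Xp, Xphi_same]
      rfl
  exact LinearMap.congr_fun₂ this a b

theorem Xphi_left (s : S) (a : Xmod ι V σ) (b : Xmod ι V σ') :
    Xphi ι V σ σ' (lAct S ι V σ s a) b = lAct S ι V (σ * σ') s (Xphi ι V σ σ' a b) := by
  have : (Xphi ι V σ σ').comp (lAct S ι V σ s) =
      (Xphi ι V σ σ').compr₂ (lAct S ι V (σ * σ') s) := by
    refine Xphi_ext (fun i j v f w g h => ?_) (fun j v f w g => ?_)
    · simp only [LinearMap.comp_apply, LinearMap.compr₂_apply, lAct_Xp, Xphi_ne _ _ _ _ _ _ h,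
        map_zero]
    · simp only [LinearMap.comp_apply, LinearMap.compr₂_apply, lAct_Xp, Xphi_same, map_smul,
        Xc_smul]
  exact LinearMap.congr_fun₂ this a b

theorem Xphi_right (s : S) (a : Xmod ι V σ) (b : Xmod ι V σ') :
    Xphi ι V σ σ' a (rAct S ι V σ' s b) = rAct S ι V (σ * σ') s (Xphi ι V σ σ' a b) := by
  have : (Xphi ι V σ σ').compl₂ (rAct S ι V σ' s) =
      (Xphi ι V σ σ').compr₂ (rAct S ι V (σ * σ') s) := by
    refine Xphi_ext (fun i j v f w g h => ?_) (fun j v f w g => ?_)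
    · simp only [LinearMap.compl₂_apply, LinearMap.compr₂_apply, rAct_Xp, Xphi_ne _ _ _ _ _ _ h,
        map_zero]
    · simp only [LinearMap.compl₂_apply, LinearMap.compr₂_apply, rAct_Xp, Xphi_same, map_smul]
  exact LinearMap.congr_fun₂ this a b

/-- The map on the quotient. -/
noncomputable def XPhi : ((Xmod ι V σ ⊗[ℂ] Xmod ι V σ') ⧸ balRel S ι V σ σ') →ₗ[ℂ]
    Xmod ι V (σ * σ') :=
  (balRel S ι V σ σ').liftQ (TensorProduct.lift (Xphi ι V σ σ')) (by
    rw [balRel, Submodule.span_le]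
    rintro z ⟨s, a, b, rfl⟩
    simp [Xphi_bal])

theorem XPhi_mk (a : Xmod ι V σ) (b : Xmod ι V σ') :
    XPhi S ι V σ σ' (Submodule.Quotient.mk (a ⊗ₜ[ℂ] b)) = Xphi ι V σ σ' a b := by
  rw [XPhi, Submodule.liftQ_apply, TensorProduct.lift.tmul]

theorem Xmk_bal (s : S) (a : Xmod ι V σ) (b : Xmod ι V σ') :
    (balRel S ι V σ σ').mkQ ((rAct S ι V σ s a) ⊗ₜ[ℂ] b) =
      (balRel S ι V σ σ').mkQ (a ⊗ₜ[ℂ] (lAct S ι V σ' s b)) := by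
  refine (Submodule.Quotient.eq _).2 (Submodule.subset_span ⟨s, a, b, rfl⟩)

/-- The inverse map. -/
noncomputable def XPsi (f0 : ∀ i, Module.Dual ℂ (V i)) (w0 : ∀ i, V i) :
    Xmod ι V (σ * σ') →ₗ[ℂ] ((Xmod ι V σ ⊗[ℂ] Xmod ι V σ') ⧸ balRel S ι V σ σ') :=
  DirectSum.toModule ℂ ι _ fun j =>
    (balRel S ι V σ σ').mkQ.comp (TensorProduct.map
      ((DirectSum.lof ℂ ι (fun j => V (σ j) ⊗[ℂ] Module.Dual ℂ (V j)) (σ' j)).comp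
        (((TensorProduct.mk ℂ (V (σ (σ' j))) (Module.Dual ℂ (V (σ' j)))).flip (f0 (σ' j))).comp
          (Xc ι V σ σ' j).symm.toLinearMap))
      ((DirectSum.lof ℂ ι (fun j => V (σ' j) ⊗[ℂ] Module.Dual ℂ (V j)) j).comp
        (TensorProduct.mk ℂ (V (σ' j)) (Module.Dual ℂ (V j)) (w0 (σ' j)))))

theorem XPsi_Xp (f0 : ∀ i, Module.Dual ℂ (V i)) (w0 : ∀ i, V i) (j : ι)
    (v : V ((σ * σ') j)) (g : Module.Dual ℂ (V j)) :
    XPsi S ι V σ σ' f0 w0 (Xp ι V (σ * σ') j v g) =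
      (balRel S ι V σ σ').mkQ
        (Xp ι V σ (σ' j) ((Xc ι V σ σ' j).symm v) (f0 (σ' j)) ⊗ₜ[ℂ] Xp ι V σ' j (w0 (σ' j)) g) := by
  unfold XPsi Xp
  rw [DirectSum.toModule_lof]
  rfl

theorem Xp_smul_left (i : ι) (c : ℂ) (v : V (σ i)) (f : Module.Dual ℂ (V i)) :
    Xp ι V σ i (c • v) f = c • Xp ι V σ i v f := by
  unfold Xp
  rw [← TensorProduct.smul_tmul', map_smul]

theorem Xp_zero_left (i : ι) (f : Module.Dual ℂ (V i)) :
    Xp ι V σ i 0 f = 0 := by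
  unfold Xp
  rw [TensorProduct.zero_tmul, map_zero]

end Xaux

/-- Let `S` be a finite-dimensional semisimple algebra over `ℂ`, with
`V i` (for `i` ranging over the set `ι` of isomorphism classes of simple left
`S`-modules) a chosen representative of each isomorphism class.  For permutations
`σ, σ'` of `ι`, the `S`-bimodules `X_σ = ⊕_i V_{σ(i)} ⊗ V_i^*` satisfy
`X_σ ⊗_S X_{σ'} ≅ X_{σ∘σ'}` as `S`-bimodules: there is a `ℂ`-linear equivalence
from the balanced tensor product to `X_{σ∘σ'}` commuting with the left and right
`S`-actions. -/
theorem Xmod_tensor_iso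
    (S : Type) [Ring S] [Algebra ℂ S] [FiniteDimensional ℂ S] [IsSemisimpleRing S]
    (ι : Type) [Fintype ι] [DecidableEq ι]
    (V : ι → Type) [∀ i, AddCommGroup (V i)] [∀ i, Module ℂ (V i)]
    [∀ i, Module S (V i)] [∀ i, SMulCommClass S ℂ (V i)]
    [∀ i, IsScalarTower ℂ S (V i)]
    (hsimple : ∀ i, IsSimpleModule S (V i))
    (hinj : ∀ i j, Nonempty (V i ≃ₗ[S] V j) → i = j)
    (hsurj : ∀ (M : Type) [AddCommGroup M] [Module S M],
      IsSimpleModule S M → ∃ i, Nonempty (M ≃ₗ[S] V i))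
    (σ σ' : Equiv.Perm ι) :
    ∃ e : ((Xmod ι V σ ⊗[ℂ] Xmod ι V σ') ⧸ balRel S ι V σ σ') ≃ₗ[ℂ]
        Xmod ι V (σ * σ'),
      (∀ (s : S) (a : Xmod ι V σ) (b : Xmod ι V σ'),
        e (Submodule.Quotient.mk ((lAct S ι V σ s a) ⊗ₜ[ℂ] b)) =
          lAct S ι V (σ * σ') s (e (Submodule.Quotient.mk (a ⊗ₜ[ℂ] b)))) ∧
      (∀ (s : S) (a : Xmod ι V σ) (b : Xmod ι V σ'),
        e (Submodule.Quotient.mk (a ⊗ₜ[ℂ] (rAct S ι V σ' s b))) =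
          rAct S ι V (σ * σ') s (e (Submodule.Quotient.mk (a ⊗ₜ[ℂ] b)))) := by
  have hnt : ∀ i, ∃ p : Module.Dual ℂ (V i) × V i, p.1 p.2 = 1 := by
    intro i
    have := IsSimpleModule.nontrivial S (V i)
    obtain ⟨w, hw⟩ := exists_ne (0 : V i)
    obtain ⟨f, hf⟩ := Module.Projective.exists_dual_ne_zero ℂ hw
    exact ⟨((f w)⁻¹ • f, w), by simp [hf]⟩
  choose p hp using hnt
  have hdens := Xaux_density S ι V hsimple hinj
  have hl : (XPhi S ι V σ σ').comp (XPsi S ι V σ σ' (fun i => (p i).1) (fun i => (p i).2)) =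
      LinearMap.id := by
    refine Xp_ext fun j v g => ?_
    rw [LinearMap.comp_apply, XPsi_Xp, Submodule.mkQ_apply, XPhi_mk, Xphi_same, hp, one_smul,
      LinearEquiv.apply_symm_apply, LinearMap.id_apply]
  have hr : (XPsi S ι V σ σ' (fun i => (p i).1) (fun i => (p i).2)).comp (XPhi S ι V σ σ') =
      LinearMap.id := by
    refine Submodule.linearMap_qext _ (TensorProduct.ext ?_)
    refine Xphi_ext (fun i j v f w g h => ?_) (fun j v f w g => ?_)
    · simp only [LinearMap.compr₂ₛₗ_apply, LinearMap.compr₂_apply, LinearMap.comp_apply, TensorProduct.mk_apply,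
        Submodule.mkQ_apply, XPhi_mk, Xphi_ne _ _ _ _ _ _ h, map_zero, LinearMap.id_apply]
      obtain ⟨s, hs1, hs2⟩ := hdens i LinearMap.id
      have hb := Xmk_bal S ι V σ σ' s (Xp ι V σ i v f) (Xp ι V σ' j w g)
      rw [rAct_Xp, lAct_Xp, hs2 _ (Ne.symm h), Xp_zero_left, TensorProduct.tmul_zero,
        map_zero] at hb
      have hf : f.comp (DistribSMul.toLinearMap ℂ (V i) s) = f := by
        ext x
        simp [hs1]
      rw [hf] at hb
      exact hb.symm
    · simp only [LinearMap.compr₂ₛₗ_apply, LinearMap.compr₂_apply, LinearMap.comp_apply, TensorProduct.mk_apply,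
        Submodule.mkQ_apply, XPhi_mk, Xphi_same, map_smul, LinearMap.id_apply]
      obtain ⟨s, hs1, hs2⟩ := hdens (σ' j) (LinearMap.toSpanSingleton ℂ _ (p (σ' j)).2 ∘ₗ f)
      have hb := Xmk_bal S ι V σ σ' s (Xp ι V σ (σ' j) v (p (σ' j)).1) (Xp ι V σ' j w g)
      have hf : (p (σ' j)).1.comp (DistribSMul.toLinearMap ℂ (V (σ' j)) s) = f := by
        ext x
        simp [hs1, hp]
      rw [rAct_Xp, lAct_Xp, hs1, hf] at hb
      simp only [LinearMap.comp_apply, LinearMap.toSpanSingleton_apply, Xp_smul_left,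
        TensorProduct.tmul_smul, map_smul] at hb
      refine Eq.trans ?_ hb.symm
      rw [XPsi_Xp, LinearEquiv.symm_apply_apply]
  refine ⟨LinearEquiv.ofLinearMap _ _ hl hr, fun s a b => ?_, fun s a b => ?_⟩
  · simp only [LinearEquiv.coe_ofLinearMap, XPhi_mk, Xphi_left]
  · simp only [LinearEquiv.coe_ofLinearMap, XPhi_mk, Xphi_right]
end

section
/- Let Q and K be finite groups and suppose H²(Q, ℂˣ) is trivial (trivial action). Then there is an isomorphism of abelian groups H²(Q, Hom(K, ℂˣ)) ≅ Ext¹_ℤ(Q_ab, Hom(K, ℂˣ)), where Q acts trivially on the character group Hom(K, ℂˣ), Q_ab denotes the abelianization of Q, and Ext¹_ℤ is the Ext group of abelian groups. -/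
open CategoryTheory

theorem aux_equiv {Z C V H W : Type*} [AddCommGroup Z] [AddCommGroup C] [AddCommGroup V]
    [AddCommGroup H] [AddCommGroup W] (T : AddSubgroup (Z × C × V))
    (p : Z →+ H) (q : V →+ W) (hp : Function.Surjective p) (hq : Function.Surjective q)
    (h1 : ∀ z, ∃ c v, (z, c, v) ∈ T) (h2 : ∀ v, ∃ z c, (z, c, v) ∈ T)
    (h3 : ∀ z c v, (z, c, v) ∈ T → (p z = 0 ↔ q v = 0)) : Nonempty (H ≃+ W) := by
  let a : T →+ H := p.comp ((AddMonoidHom.fst Z (C × V)).comp T.subtype)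
  let b : T →+ W := q.comp ((AddMonoidHom.snd C V).comp
    ((AddMonoidHom.snd Z (C × V)).comp T.subtype))
  have ha : Function.Surjective a := by
    intro h
    obtain ⟨z, rfl⟩ := hp h
    obtain ⟨c, v, hT⟩ := h1 z
    exact ⟨⟨_, hT⟩, rfl⟩
  have hb : Function.Surjective b := by
    intro h
    obtain ⟨v, rfl⟩ := hq h
    obtain ⟨z, c, hT⟩ := h2 v
    exact ⟨⟨_, hT⟩, rfl⟩
  have hk : a.ker = b.ker := by
    ext ⟨⟨z, c, v⟩, hT⟩
    exact h3 z c v hT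
  exact ⟨(QuotientAddGroup.quotientKerEquivOfSurjective a ha).symm.trans
    ((QuotientAddGroup.quotientAddEquivOfEq hk).trans
      (QuotientAddGroup.quotientKerEquivOfSurjective b hb))⟩

theorem aux_sc {R : Type} [Ring R] (S : ShortComplex (ModuleCat.{0} R)) :
    ∃ p : LinearMap.ker S.g.hom →+ S.homology, Function.Surjective p ∧
      ∀ z, p z = 0 ↔ ∃ c : S.X₁, S.f c = z.1 := by
  let e' := S.moduleCatHomologyIso.toLinearEquiv.toAddEquiv
  let q : LinearMap.ker S.g.hom →+ S.moduleCatLeftHomologyData.H :=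
    (Submodule.mkQ (LinearMap.range S.moduleCatToCycles)).toAddMonoidHom
  refine ⟨e'.symm.toAddMonoidHom.comp q, ?_, ?_⟩
  · exact e'.symm.surjective.comp (Submodule.mkQ_surjective _)
  · intro z
    refine (EmbeddingLike.map_eq_zero_iff (f := e'.symm) (x := q z)).trans ?_
    refine (Submodule.Quotient.mk_eq_zero (LinearMap.range S.moduleCatToCycles)).trans ?_
    constructor
    · rintro ⟨c, hc⟩
      exact ⟨c, congrArg Subtype.val hc⟩
    · rintro ⟨c, hc⟩
      exact ⟨c, Subtype.ext hc⟩

theorem aux_homology {R : Type} [Ring R] (K : CochainComplex (ModuleCat.{0} R) ℕ) :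
    ∃ p : LinearMap.ker (K.d 1 2).hom →+ K.homology 1, Function.Surjective p ∧
      ∀ z, p z = 0 ↔ ∃ c : K.X 0, (K.d 0 1) c = z.1 := by
  let e : K.homology 1 ≅ (K.sc' 0 1 2).homology :=
    ShortComplex.homologyMapIso (K.isoSc' 0 1 2 (by simp) (by simp))
  let e' := e.toLinearEquiv.toAddEquiv
  obtain ⟨p, hp, hp0⟩ := aux_sc (K.sc' 0 1 2)
  refine ⟨e'.symm.toAddMonoidHom.comp p, e'.symm.surjective.comp hp, fun z => ?_⟩
  exact (EmbeddingLike.map_eq_zero_iff (f := e'.symm) (x := p z)).trans (hp0 z)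

/-- cokernel of `Hom(X, X₂) → Hom(X, X₃)` -/
abbrev CokerHom (X : ModuleCat.{0} ℤ) (S : ShortComplex (ModuleCat.{0} ℤ)) : Type :=
  (X ⟶ S.X₃) ⧸ (Preadditive.rightComp X S.g).range

theorem aux_ext (X : ModuleCat.{0} ℤ) (S : ShortComplex (ModuleCat.{0} ℤ)) (hS : S.ShortExact)
    [Injective S.X₂] :
    Nonempty (((Ext ℤ (ModuleCat ℤ) 1).obj (Opposite.op X)).obj S.X₁ ≃+ CokerHom X S) := by
  let P := ProjectiveResolution.of X
  have := hS.mono_f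
  have := hS.epi_g
  let K := P.complex.linearYonedaObj ℤ S.X₁
  obtain ⟨p, hp, hp0⟩ := aux_homology K
  obtain ⟨π, hπ, hdπ, hdesc⟩ : ∃ π : P.complex.X 0 ⟶ X, Epi π ∧ P.complex.d 1 0 ≫ π = 0 ∧
      ∀ (Y : ModuleCat.{0} ℤ) (g : P.complex.X 0 ⟶ Y), P.complex.d 1 0 ≫ g = 0 →
        ∃ φ : X ⟶ Y, π ≫ φ = g :=
    ⟨P.π.f 0, inferInstanceAs (Epi (P.π.f 0)), P.complex_d_comp_π_f_zero, fun Y g hg =>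
      ⟨_, (Limits.CokernelCofork.IsColimit.desc' P.isColimitCokernelCofork g hg).2⟩⟩
  have hd (c : P.complex.X 0 ⟶ S.X₁) : (K.d 0 1) c = P.complex.d 1 0 ≫ c := rfl
  have hd' (c : P.complex.X 1 ⟶ S.X₁) : (K.d 1 2) c = P.complex.d 2 1 ≫ c := rfl
  let T : AddSubgroup (LinearMap.ker (K.d 1 2).hom × (P.complex.X 0 ⟶ S.X₂) × (X ⟶ S.X₃)) :=
    { carrier := {t | (show P.complex.X 1 ⟶ S.X₁ from t.1.1) ≫ S.f = P.complex.d 1 0 ≫ t.2.1 ∧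
        t.2.1 ≫ S.g = π ≫ t.2.2}
      zero_mem' := by
        constructor
        · exact Limits.zero_comp.trans Limits.comp_zero.symm
        · exact Limits.zero_comp.trans Limits.comp_zero.symm
      add_mem' := by
        rintro ⟨⟨a, _⟩, b, c⟩ ⟨⟨a', _⟩, b', c'⟩ ⟨h1, h2⟩ ⟨h3, h4⟩
        constructor
        · refine (Preadditive.add_comp _ _ _ _ _ _).trans (Eq.trans ?_ (Preadditive.comp_add _ _ _ _ _ _).symm)
          exact congrArg₂ (· + ·) h1 h3
        · refine (Preadditive.add_comp _ _ _ _ _ _).trans (Eq.trans ?_ (Preadditive.comp_add _ _ _ _ _ _).symm)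
          exact congrArg₂ (· + ·) h2 h4
      neg_mem' := by
        rintro ⟨⟨a, _⟩, b, c⟩ ⟨h1, h2⟩
        constructor
        · refine (Preadditive.neg_comp _ _).trans (Eq.trans ?_ (Preadditive.comp_neg _ _).symm)
          exact congrArg (- ·) h1
        · refine (Preadditive.neg_comp _ _).trans (Eq.trans ?_ (Preadditive.comp_neg _ _).symm)
          exact congrArg (- ·) h2 }
  suffices h : Nonempty (K.homology 1 ≃+ CokerHom X S) from
    ⟨(P.isoExt 1 S.X₁).toLinearEquiv.toAddEquiv.trans h.some⟩
  refine aux_equiv T p (QuotientAddGroup.mk' (Preadditive.rightComp X S.g).range) hp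
    (QuotientAddGroup.mk'_surjective _) ?_ ?_ ?_
  · rintro ⟨z, hz⟩
    change P.complex.X 1 ⟶ S.X₁ at z
    replace hz : P.complex.d 2 1 ≫ z = 0 := hz
    let g := (P.exact_succ 0).descToInjective (z ≫ S.f) (by simp [reassoc_of% hz])
    have hg : P.complex.d 1 0 ≫ g = z ≫ S.f := (P.exact_succ 0).comp_descToInjective _ _
    obtain ⟨φ, hφ⟩ := hdesc _ (g ≫ S.g)
      (by rw [reassoc_of% hg, S.zero, Limits.comp_zero])
    exact ⟨g, φ, hg.symm, hφ.symm⟩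
  · intro φ
    let g := Projective.factorThru (π ≫ φ) S.g
    have hg : g ≫ S.g = π ≫ φ := Projective.factorThru_comp _ _
    obtain ⟨z, hz⟩ := Limits.KernelFork.IsLimit.lift' hS.fIsKernel (P.complex.d 1 0 ≫ g)
      (by rw [Category.assoc, hg, reassoc_of% hdπ, Limits.zero_comp])
    replace hz : z ≫ S.f = P.complex.d 1 0 ≫ g := hz
    refine ⟨⟨z, ?_⟩, g, hz, hg⟩
    change P.complex.d 2 1 ≫ z = 0
    rw [← cancel_mono S.f, Category.assoc, hz]
    simp
  · rintro ⟨z, hz⟩ g φ ⟨h1, h2⟩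
    change P.complex.X 1 ⟶ S.X₁ at z
    change z ≫ S.f = P.complex.d 1 0 ≫ g at h1
    change g ≫ S.g = π ≫ φ at h2
    rw [hp0, QuotientAddGroup.mk'_apply, QuotientAddGroup.eq_zero_iff]
    constructor
    · rintro ⟨c, hc⟩
      change P.complex.X 0 ⟶ S.X₁ at c
      change P.complex.d 1 0 ≫ c = z at hc
      obtain ⟨ψ, hψ⟩ := hdesc _ (g - c ≫ S.f)
        (by rw [Preadditive.comp_sub, ← h1, reassoc_of% hc, sub_self])
      refine ⟨ψ, ?_⟩
      change ψ ≫ S.g = φ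
      rw [← cancel_epi (π), reassoc_of% hψ, ← h2]
      simp
    · rintro ⟨ψ, hψ⟩
      change ψ ≫ S.g = φ at hψ
      obtain ⟨c, hc⟩ := Limits.KernelFork.IsLimit.lift' hS.fIsKernel (g - π ≫ ψ)
        (by rw [Preadditive.sub_comp, h2, Category.assoc, hψ, sub_self])
      change c ≫ S.f = _ at hc
      refine ⟨c, ?_⟩
      change P.complex.d 1 0 ≫ c = z
      rw [← cancel_mono S.f, Category.assoc, hc, h1, Preadditive.comp_sub,
        reassoc_of% hdπ, Limits.zero_comp, sub_zero]

open groupCohomology in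
theorem aux_group (Q : Type) [Group Q] (S : ShortComplex (ModuleCat.{0} ℤ)) (hS : S.ShortExact)
    (hQ : ∀ f : cocycles₂ (Rep.trivial ℤ Q S.X₂), ∃ g : Q → S.X₂, ∀ a b,
      f (a, b) = g b - g (a * b) + g a) :
    Nonempty (groupCohomology (Rep.trivial ℤ Q S.X₁) 2 ≃+
      CokerHom (ModuleCat.of ℤ (Additive (Abelianization Q))) S) := by
  have hf : Function.Injective S.f := hS.moduleCat_injective_f
  have hg : Function.Surjective S.g := hS.moduleCat_surjective_g
  have hex : ∀ x, S.g x = 0 → ∃ y, S.f y = x := S.moduleCat_exact_iff.1 hS.exact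
  have h0 : ∀ x, S.g (S.f x) = 0 := S.moduleCat_zero_apply
  -- homomorphisms out of the abelianization
  have hlift : ∀ (E : ModuleCat.{0} ℤ) (u : Q → E), (∀ a b, u (a * b) = u a + u b) →
      ∃ φ : ModuleCat.of ℤ (Additive (Abelianization Q)) ⟶ E,
        ∀ a, φ (Additive.ofMul (Abelianization.of a)) = u a := by
    intro E u hu
    let u' : Q →* Multiplicative E := MonoidHom.mk' (fun a => Multiplicative.ofAdd (u a)) hu
    refine ⟨ModuleCat.ofHom
      { toFun := MonoidHom.toAdditiveLeft (Abelianization.lift u')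
        map_add' := map_add _
        map_smul' := fun n x => map_intCast_smul
          (MonoidHom.toAdditiveLeft (Abelianization.lift u')) ℤ ℤ n x }, ?_⟩
    intro a
    rfl
  have hext : ∀ (E : ModuleCat.{0} ℤ)
      (φ ψ : ModuleCat.of ℤ (Additive (Abelianization Q)) ⟶ E),
      (∀ a, φ (Additive.ofMul (Abelianization.of a)) = ψ (Additive.ofMul (Abelianization.of a))) →
      φ = ψ := by
    intro E φ ψ h
    ext x
    obtain ⟨a, rfl⟩ := QuotientGroup.mk_surjective x.toMul
    exact h a
  have hmul : ∀ (E : ModuleCat.{0} ℤ) (φ : ModuleCat.of ℤ (Additive (Abelianization Q)) ⟶ E)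
      (a b : Q), φ (Additive.ofMul (Abelianization.of (a * b))) =
        φ (Additive.ofMul (Abelianization.of a)) + φ (Additive.ofMul (Abelianization.of b)) := by
    intro E φ a b
    exact map_add φ.hom (Additive.ofMul (Abelianization.of a))
      (Additive.ofMul (Abelianization.of b))
  let T : AddSubgroup (cocycles₂ (Rep.trivial ℤ Q S.X₁) × (Q → S.X₂) ×
      (ModuleCat.of ℤ (Additive (Abelianization Q)) ⟶ S.X₃)) :=
    { carrier := {t | (∀ a b : Q, S.f (t.1 (a, b)) = t.2.1 b - t.2.1 (a * b) + t.2.1 a) ∧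
        ∀ a, S.g (t.2.1 a) = t.2.2 (Additive.ofMul (Abelianization.of a))}
      zero_mem' := by
        constructor
        · intro a b
          change S.f 0 = (0 : S.X₂) - 0 + 0
          simp
        · intro a
          change S.g 0 = 0
          simp
      add_mem' := by
        rintro ⟨z, b, c⟩ ⟨z', b', c'⟩ ⟨h1, h2⟩ ⟨h3, h4⟩
        constructor
        · intro x y
          refine (map_add S.f.hom (z (x, y)) (z' (x, y))).trans ?_
          refine (congrArg₂ (· + ·) (h1 x y) (h3 x y)).trans ?_
          simp only [Prod.mk_add_mk, Pi.add_apply]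
          abel
        · intro x
          refine (map_add S.g.hom (b x) (b' x)).trans ?_
          exact congrArg₂ (· + ·) (h2 x) (h4 x)
      neg_mem' := by
        rintro ⟨z, b, c⟩ ⟨h1, h2⟩
        constructor
        · intro x y
          refine (map_neg S.f.hom (z (x, y))).trans ?_
          refine (congrArg (- ·) (h1 x y)).trans ?_
          simp only [Prod.neg_mk, Pi.neg_apply]
          abel
        · intro x
          refine (map_neg S.g.hom (b x)).trans ?_
          exact congrArg (- ·) (h2 x) }
  refine aux_equiv T (H2π (Rep.trivial ℤ Q S.X₁)).hom.toAddMonoidHom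
    (QuotientAddGroup.mk' (Preadditive.rightComp _ S.g).range)
    ((ModuleCat.epi_iff_surjective _).1 inferInstance)
    (QuotientAddGroup.mk'_surjective _) ?_ ?_ ?_
  · intro z
    have hz : (fun x => S.f (z x)) ∈ cocycles₂ (Rep.trivial ℤ Q S.X₂) := by
      rw [mem_cocycles₂_iff]
      intro a b c
      have := (mem_cocycles₂_iff _).1 z.2 a b c
      have h2 := congrArg S.f this
      exact (map_add S.f.hom _ _).symm.trans (h2.trans (map_add S.f.hom _ _))
    obtain ⟨g, hgz⟩ := hQ ⟨_, hz⟩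
    replace hgz : ∀ a b, S.f (z (a, b)) = g b - g (a * b) + g a := hgz
    obtain ⟨φ, hφ⟩ := hlift S.X₃ (fun a => S.g (g a)) (by
      intro a b
      have := congrArg S.g (hgz a b)
      rw [h0, map_add, map_sub] at this
      rw [← sub_eq_zero, ← neg_eq_zero, this]
      abel)
    exact ⟨g, φ, hgz, fun a => (hφ a).symm⟩
  · intro φ
    choose g hgφ using fun a : Q => hg (φ (Additive.ofMul (Abelianization.of a)))
    have : ∀ x : Q × Q, ∃ y, S.f y = g x.2 - g (x.1 * x.2) + g x.1 := by
      intro x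
      apply hex
      rw [map_add, map_sub, hgφ, hgφ, hgφ, hmul]
      abel
    choose z hz using this
    refine ⟨⟨z, ?_⟩, g, fun a b => hz (a, b), hgφ⟩
    rw [mem_cocycles₂_iff]
    intro a b c
    apply hf
    change S.f (z _ + z _) = S.f (z _ + z _)
    rw [map_add, map_add, hz, hz, hz, hz]
    simp only [mul_assoc]
    abel
  · rintro z g φ ⟨h1, h2⟩
    change ∀ a b : Q, S.f (z (a, b)) = g b - g (a * b) + g a at h1
    change ∀ a, S.g (g a) = φ _ at h2
    rw [QuotientAddGroup.mk'_apply, QuotientAddGroup.eq_zero_iff]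
    refine (H2π_eq_zero_iff z).trans ?_
    constructor
    · rintro ⟨c, hc⟩
      change Q → S.X₁ at c
      have hc' : ∀ a b, c b - c (a * b) + c a = z (a, b) := fun a b => congrFun hc (a, b)
      obtain ⟨ψ, hψ⟩ := hlift S.X₂ (fun a => g a - S.f (c a)) (by
        intro a b
        have := h1 a b
        rw [← hc', map_add, map_sub] at this
        rw [← sub_eq_zero] at this ⊢
        rw [← this]
        abel)
      refine ⟨ψ, hext _ _ _ ?_⟩
      intro a
      change S.g (ψ _) = _
      rw [hψ, map_sub, h0, h2, sub_zero]
    · rintro ⟨ψ, rfl⟩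
      have : ∀ a : Q, ∃ y, S.f y = g a - ψ (Additive.ofMul (Abelianization.of a)) := by
        intro a
        apply hex
        rw [map_sub, h2]
        exact sub_self _
      choose c hc using this
      refine ⟨c, funext fun x => hf ?_⟩
      obtain ⟨a, b⟩ := x
      change S.f (c b - c (a * b) + c a) = S.f (z (a, b))
      rw [h1, map_add, map_sub, hc, hc, hc, hmul]
      abel

open groupCohomology in
theorem aux_main (Q : Type) [Group Q] (A D : Type) [AddCommGroup A] [AddCommGroup D]
    (i : A →+ D) (hi : Function.Injective i)
    (hroot : ∀ n : ℤ, n ≠ 0 → Function.Surjective (fun d : D => n • d))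
    (hQ : ∀ f : cocycles₂ (Rep.trivial ℤ Q D), ∃ g : Q → D, ∀ a b,
      f (a, b) = g b - g (a * b) + g a) :
    Nonempty (groupCohomology (Rep.trivial ℤ Q A) 2 ≃+
      ((Ext ℤ (ModuleCat ℤ) 1).obj
        (Opposite.op (ModuleCat.of ℤ (Additive (Abelianization Q))))).obj (ModuleCat.of ℤ A)) := by
  let p := QuotientAddGroup.mk' i.range
  let S : ShortComplex (ModuleCat.{0} ℤ) :=
    { X₁ := ModuleCat.of ℤ (A)
      X₂ := ModuleCat.of ℤ D
      X₃ := ModuleCat.of ℤ (D ⧸ i.range)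
      f := ModuleCat.ofHom i.toIntLinearMap
      g := ModuleCat.ofHom p.toIntLinearMap
      zero := by
        ext x
        exact (QuotientAddGroup.eq_zero_iff _).2 ⟨x, rfl⟩ }
  have hS : S.ShortExact :=
    { exact := by
        rw [ShortComplex.moduleCat_exact_iff]
        intro x hx
        exact (QuotientAddGroup.eq_zero_iff _).1 hx
      mono_f := (ModuleCat.mono_iff_injective _).2 hi
      epi_g := (ModuleCat.epi_iff_surjective _).2 (QuotientAddGroup.mk'_surjective _) }
  let : DivisibleBy D ℤ := divisibleByOfSMulRightSurj D ℤ (fun {n} hn => hroot n hn)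
  have : Injective S.X₂ :=
    Module.injective_object_of_injective_module (inj := (Module.Baer.of_divisible D).injective)
  obtain ⟨e1⟩ := aux_group Q S hS hQ
  obtain ⟨e2⟩ := aux_ext (ModuleCat.of ℤ (Additive (Abelianization Q))) S hS
  exact ⟨e1.trans e2.symm⟩

open groupCohomology in
theorem h2_iso_ext_abelianization
    (Q K : Type) [Group Q] [Finite Q] [Group K] [Finite K]
    (hQ : Subsingleton (groupCohomology (Rep.trivial ℤ Q (Additive ℂˣ)) 2)) :
    Nonempty
      (groupCohomology (Rep.trivial ℤ Q (Additive (K →* ℂˣ))) 2 ≃+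
        ((Ext ℤ (ModuleCat ℤ) 1).obj
            (Opposite.op (ModuleCat.of ℤ (Additive (Abelianization Q))))).obj
          (ModuleCat.of ℤ (Additive (K →* ℂˣ)))) := by
  let D := K → Additive ℂˣ
  let i : Additive (K →* ℂˣ) →+ D :=
    { toFun := fun χ k => Additive.ofMul (χ.toMul k)
      map_zero' := rfl
      map_add' := fun _ _ => rfl }
  have hi : Function.Injective i := by
    intro χ χ' h
    refine MonoidHom.ext (M := K) (N := ℂˣ) fun k => ?_
    exact congrFun h k
  have hroot : ∀ n : ℤ, n ≠ 0 → Function.Surjective (fun d : D => n • d) := by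
    have key : ∀ n : ℕ, n ≠ 0 → Function.Surjective (fun d : D => n • d) := by
      intro n hn d
      have : ∀ k, ∃ y : ℂˣ, y ^ n = (d k).toMul := by
        intro k
        obtain ⟨w, hw⟩ := IsAlgClosed.exists_pow_nat_eq ((d k).toMul : ℂ) (Nat.pos_of_ne_zero hn)
        have hw0 : w ≠ 0 := by
          rintro rfl
          rw [zero_pow hn] at hw
          exact (d k).toMul.ne_zero hw.symm
        exact ⟨Units.mk0 w hw0, Units.ext (by simpa using hw)⟩
      choose y hy using this
      exact ⟨fun k => Additive.ofMul (y k), funext hy⟩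
    intro n hn d
    obtain ⟨y, hy⟩ := key n.natAbs (by simpa using hn) d
    rcases Int.natAbs_eq n with h | h
    · refine ⟨y, ?_⟩
      change n • y = d
      rw [h, natCast_zsmul]
      exact hy
    · refine ⟨-y, ?_⟩
      change n • (-y) = d
      rw [h, neg_smul_neg, natCast_zsmul]
      exact hy
  exact aux_main Q _ D i hi hroot (by
    intro f
    have : ∀ k : K, ∃ g : Q → Additive ℂˣ, ∀ a b,
        (show D from f (a, b)) k = g b - g (a * b) + g a := by
      intro k
      have hk : (fun x => (show D from f x) k) ∈ cocycles₂ (Rep.trivial ℤ Q (Additive ℂˣ)) := by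
        rw [mem_cocycles₂_iff]
        intro a b c
        exact congrFun ((mem_cocycles₂_iff _).1 f.2 a b c) k
      obtain ⟨g, hg⟩ := (H2π_eq_zero_iff ⟨_, hk⟩).1 (hQ.elim _ _)
      exact ⟨g, fun a b => (congrFun hg (a, b)).symm⟩
    choose g hg using this
    exact ⟨fun a k => g k a, fun a b => funext fun k => hg k a b⟩)
end
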